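/- In a finite cost game with exact potential Φ, for every strategy profile s₀ there exists a natural number n and a finite improvement path of length n from s₀ (each consecutive pair a unilateral improvement step) that cannot be extended by any further unilateral improvement step, and the final profile of every such non-extendable improvement path is a Nash equilibrium. -/

import Mathlib

/-- `Φ` is an exact potential for the cost game with cost functions `u`:
for every player `i`, profile `s`, and strategy `a : S i`,
`u i (update s i a) - u i s = Φ (update s i a) - Φ s`. -/
def ExactPotential {ι : Type*} [DecidableEq ι] {S : ι → Type*}
    (u : (i : ι) → ((j : ι) → S j) → ℝ) (Φ : ((j : ι) → S j) → ℝ) : Prop :=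
  ∀ (i : ι) (s : (j : ι) → S j) (a : S i),
    u i (Function.update s i a) - u i s = Φ (Function.update s i a) - Φ s

/-- A unilateral improvement step from `s` to `s'`: some player `i` switches to a
strategy `a` (`s' = update s i a`) and strictly decreases its own cost. -/
def ImprovementStep {ι : Type*} [DecidableEq ι] {S : ι → Type*}
    (u : (i : ι) → ((j : ι) → S j) → ℝ) (s s' : (j : ι) → S j) : Prop :=
  ∃ (i : ι) (a : S i), s' = Function.update s i a ∧ u i s' < u i s

/-- `s` is a Nash equilibrium of the cost game `u`: no player can strictly
decrease its own cost by a unilateral deviation. -/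
def NashEquilibrium {ι : Type*} [DecidableEq ι] {S : ι → Type*}
    (u : (i : ι) → ((j : ι) → S j) → ℝ) (s : (j : ι) → S j) : Prop :=
  ∀ (i : ι) (a : S i), u i s ≤ u i (Function.update s i a)

theorem ImprovementStep.potential_lt {ι : Type*} [DecidableEq ι] {S : ι → Type*}
    {u : (i : ι) → ((j : ι) → S j) → ℝ} {Φ : ((j : ι) → S j) → ℝ}
    (hΦ : ExactPotential u Φ) {s s' : (j : ι) → S j} (h : ImprovementStep u s s') :
    Φ s' < Φ s := by
  obtain ⟨i, a, rfl, hlt⟩ := h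
  linarith [hΦ i s a]

/-- On a finite type, a relation that strictly decreases a real-valued function admits, from every
point, a finite path that cannot be extended. -/
theorem exists_maximal_path_of_decreasing {α : Type*} [Finite α] {r : α → α → Prop} {f : α → ℝ}
    (hf : ∀ {x y}, r x y → f y < f x) (x₀ : α) :
    ∃ (n : ℕ) (x : Fin (n + 1) → α), x 0 = x₀ ∧
      (∀ k : Fin n, r (x k.castSucc) (x k.succ)) ∧ ¬ ∃ y, r (x (Fin.last n)) y := by
  have : IsTrans α (fun x y => f x < f y) := ⟨fun _ _ _ => lt_trans⟩
  have : Std.Irrefl (fun x y : α => f x < f y) := ⟨fun _ => lt_irrefl _⟩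
  have wf : WellFounded fun x y : α => f x < f y := Finite.wellFounded_of_trans_of_irrefl _
  induction x₀ using wf.induction with
  | _ x₀ ih =>
    by_cases h : ∃ y, r x₀ y
    · obtain ⟨y, hy⟩ := h
      obtain ⟨n, x, h0, hstep, hmax⟩ := ih y (hf hy)
      refine ⟨n + 1, Fin.cons x₀ x, rfl, fun k => ?_, ?_⟩
      · cases k using Fin.cases with
        | zero => simpa [h0] using hy
        | succ k => simpa [← Fin.succ_castSucc] using hstep k
      · simpa [← Fin.succ_last] using hmax
    · exact ⟨0, fun _ => x₀, rfl, fun k => k.elim0, h⟩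

theorem nashEquilibrium_of_not_exists_improvementStep {ι : Type*} [DecidableEq ι] {S : ι → Type*}
    {u : (i : ι) → ((j : ι) → S j) → ℝ} {s : (j : ι) → S j}
    (h : ¬ ∃ s', ImprovementStep u s s') : NashEquilibrium u s :=
  fun i a => le_of_not_gt fun hlt => h ⟨_, i, a, rfl, hlt⟩

/-- From every initial profile there is a non-extendable finite
improvement path, and the final profile of every such non-extendable
improvement path is a Nash equilibrium. -/
theorem maximal_improvement_paths_end_at_nash
    {ι : Type*} [Fintype ι] [Nonempty ι] [DecidableEq ι]
    {S : ι → Type*} [∀ i, Fintype (S i)] [∀ i, Nonempty (S i)]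
    (u : (i : ι) → ((j : ι) → S j) → ℝ) (Φ : ((j : ι) → S j) → ℝ)
    (hΦ : ExactPotential u Φ) :
    (∀ s₀ : (j : ι) → S j,
      ∃ (n : ℕ) (s : Fin (n + 1) → ((j : ι) → S j)),
        s 0 = s₀ ∧
        (∀ k : Fin n, ImprovementStep u (s k.castSucc) (s k.succ)) ∧
        ¬ ∃ s' : (j : ι) → S j, ImprovementStep u (s (Fin.last n)) s') ∧
    (∀ (n : ℕ) (s : Fin (n + 1) → ((j : ι) → S j)),
      (∀ k : Fin n, ImprovementStep u (s k.castSucc) (s k.succ)) →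
      (¬ ∃ s' : (j : ι) → S j, ImprovementStep u (s (Fin.last n)) s') →
      NashEquilibrium u (s (Fin.last n))) :=
  ⟨exists_maximal_path_of_decreasing (ImprovementStep.potential_lt hΦ),
    fun _ _ _ => nashEquilibrium_of_not_exists_improvementStep⟩
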